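/- arXiv:1712.00797 — 2 statements merged into one kernel-verified Lean document; each statement's English description precedes it below -/
import Mathlib

section
/- For k ∈ ℕ, k ≥ 1, set A_k := ( π/(k + 1/2), π/k ) and B_k := ( π/(k+1), π/(k + 1/2) ). If k is even then the function T_0 ↦ T_opt(T_0) is continuous on the interval A_k; if k is odd then T_0 ↦ T_opt(T_0) is continuous on the interval B_k. -/
open MeasureTheory Set Real Filter Topology

noncomputable section

instance : Fact (0 < 2 * Real.pi) := ⟨by positivity⟩

/-- λ_k: 0 for even k, π for odd k. -/
def lam (k : ℕ) : ℝ := if Even k then 0 else Real.pi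

/-- Covered set D(T₀, t) ⊆ ℝ/(2πℤ): the union over k of the projections of the
observation intervals (k·T₀, min((k+1)·T₀, t)) translated by −λ_k. -/
def coveredSet (T0 t : ℝ) : Set (AddCircle (2 * Real.pi)) :=
  ⋃ k : ℕ, (fun a : ℝ => ((a - lam k : ℝ) : AddCircle (2 * Real.pi))) ''
    Set.Ioo ((k : ℝ) * T0) (min (((k : ℝ) + 1) * T0) t)

/-- Optimal control time T_opt(T₀). -/
def Topt (T0 : ℝ) : ℝ :=
  sInf { t : ℝ | 0 < t ∧ volume (coveredSet T0 t)ᶜ = 0 }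

lemma cov_zero (T t : ℝ)
    (h : ∀ x : ℝ, 0 ≤ x → x < 2 * π → (∀ n m : ℤ, x ≠ n * T + m * π) →
      ∃ (j : ℕ) (n : ℤ) (a : ℝ), a = x + lam j + n * (2 * π) ∧ j * T < a ∧ a < (j + 1) * T ∧ a < t) :
    volume (coveredSet T t)ᶜ = 0 := by
  have hE : (Set.range (fun p : ℤ × ℤ => (((p.1 : ℝ) * T + p.2 * π : ℝ) : AddCircle (2 * π)))).Countable :=
    Set.countable_range _
  have hsing : ∀ q : AddCircle (2 * π), volume ({q} : Set (AddCircle (2 * π))) = 0 := by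
    intro q
    have := AddCircle.volume_closedBall (T := 2 * π) (x := q) 0
    rw [Metric.closedBall_zero] at this
    rw [this]
    have : min (2 * π) (2 * 0) = 0 := by
      rw [mul_zero]; exact min_eq_right (by positivity)
    rw [this]; simp
  refine measure_mono_null (t := Set.range (fun p : ℤ × ℤ => (((p.1 : ℝ) * T + p.2 * π : ℝ) : AddCircle (2 * π)))) ?_ ?_
  · intro q hq
    by_contra hqE
    apply hq
    have hq2 : q ∈ (QuotientAddGroup.mk '' Set.Ico (0:ℝ) (0 + 2 * π) : Set (AddCircle (2 * π))) := by
      rw [AddCircle.coe_image_Ico_eq]; trivial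
    obtain ⟨x, hx, rfl⟩ := hq2
    obtain ⟨j, n, a, ha, h1, h2, h3⟩ := h x hx.1 (by linarith [hx.2]) (by
      intro n m hnm
      exact hqE ⟨(n, m), by simp only [hnm]⟩)
    refine mem_iUnion.2 ⟨j, a, ⟨h1, lt_min h2 h3⟩, ?_⟩
    have : a - lam j = x + n • (2 * π) := by rw [ha, zsmul_eq_mul]; ring
    simp only [this]
    rw [AddCircle.coe_add, AddCircle.coe_zsmul, AddCircle.coe_period]
    simp
  · rw [← Set.biUnion_of_singleton (Set.range _)]
    exact (measure_biUnion_null_iff hE).2 fun q _ => hsing q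

lemma cov_pos (T t l u : ℝ) (hlu : l < u)
    (h : ∀ x : ℝ, l < x → x < u → ∀ (j : ℕ) (n : ℤ) (a : ℝ), a = x + lam j + n * (2 * π) →
      j * T < a → a < (j + 1) * T → a < t → False) :
    volume (coveredSet T t)ᶜ ≠ 0 := by
  intro h0
  have hop : IsOpen ((QuotientAddGroup.mk : ℝ → AddCircle (2 * π)) '' Set.Ioo l u) :=
    QuotientAddGroup.isOpenMap_coe _ isOpen_Ioo
  have hne : ((QuotientAddGroup.mk : ℝ → AddCircle (2 * π)) '' Set.Ioo l u).Nonempty :=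
    (nonempty_Ioo.2 hlu).image _
  refine (hop.measure_pos volume hne).ne' (measure_mono_null ?_ h0)
  rintro _ ⟨x, hx, rfl⟩ hc
  obtain ⟨j, a, ha, hax⟩ := mem_iUnion.1 hc
  have hax' : ((a - lam j : ℝ) : AddCircle (2 * π)) = (x : AddCircle (2 * π)) := hax
  rw [← sub_eq_zero, ← AddCircle.coe_sub, AddCircle.coe_eq_zero_iff] at hax'
  obtain ⟨n, hn⟩ := hax'
  rw [zsmul_eq_mul] at hn
  exact h x hx.1 hx.2 j n a (by linarith) ha.1 (ha.2.trans_le (min_le_left _ _))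
    (ha.2.trans_le (min_le_right _ _))

lemma lam_e (p : ℕ) : lam (2 * p) = 0 := by simp [lam]
lemma lam_o (p : ℕ) : lam (2 * p + 1) = π := by simp [lam]

lemma topt_A (q : ℕ) (T d : ℝ) (hq : 1 ≤ q) (hd : 0 < d) (hdT : 2 * d < T)
    (hpi : π = 2 * q * T + d) : Topt T = 2 * π + 2 * q * T := by
  have hT : 0 < T := by linarith
  have hp := Real.pi_pos
  have hqT : (1:ℝ) * T ≤ q * T := mul_le_mul_of_nonneg_right (by exact_mod_cast hq) hT.le
  refine IsLeast.csInf_eq ⟨⟨by positivity, cov_zero _ _ ?_⟩, ?_⟩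
  · intro x hx0 hx1 hne
    obtain ⟨i, hi1, hi2⟩ : ∃ i : ℕ, i * T ≤ x ∧ x < (i + 1) * T :=
      ⟨⌊x / T⌋₊, (le_div_iff₀ hT).1 (Nat.floor_le (by positivity)),
        (div_lt_iff₀ hT).1 (Nat.lt_floor_add_one _)⟩
    have hi1' : i * T < x := lt_of_le_of_ne hi1 (fun h => hne i 0 (by push_cast; linarith))
    rcases Nat.even_or_odd' i with ⟨p, rfl | rfl⟩
    · exact ⟨2 * p, 0, x, by rw [lam_e]; simp, hi1', hi2, by linarith⟩
    push_cast at hi1 hi2 hi1'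
    rcases lt_or_ge x π with hxp | hxp
    · rcases lt_or_ge x ((2 * p + 2) * T - d) with h | h
      · refine ⟨2 * (p + q) + 1, 0, x + π, by rw [lam_o]; simp, ?_, ?_, ?_⟩ <;> push_cast <;> linarith
      · have : 2 * p + 1 < 2 * q + 1 := by
          have : ((2 * p + 1 : ℕ) : ℝ) < ((2 * q + 1 : ℕ) : ℝ) := by
            refine lt_of_mul_lt_mul_right ?_ hT.le
            push_cast; linarith
          exact_mod_cast this
        have h3 : ((p + 1 : ℕ) : ℝ) * T ≤ q * T :=
          mul_le_mul_of_nonneg_right (by exact_mod_cast (by omega : p + 1 ≤ q)) hT.le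
        push_cast at h3
        refine ⟨2 * (p + 1 + 2 * q), 1, x + 2 * π, by rw [lam_e]; simp, ?_, ?_, ?_⟩ <;> push_cast <;> linarith
    · rcases lt_or_ge x ((2 * p + 1) * T + d) with h | h
      · have : 2 * p + 1 < 4 * q + 1 := by
          have : ((2 * p + 1 : ℕ) : ℝ) < ((4 * q + 1 : ℕ) : ℝ) := by
            refine lt_of_mul_lt_mul_right ?_ hT.le
            push_cast; linarith
          exact_mod_cast this
        have h3 : ((p + 1 : ℕ) : ℝ) * T ≤ (2 * q : ℕ) * T :=
          mul_le_mul_of_nonneg_right (by exact_mod_cast (by omega : p + 1 ≤ 2 * q)) hT.le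
        push_cast at h3
        refine ⟨2 * (p + q) + 1, 0, x + π, by rw [lam_o]; simp, ?_, ?_, ?_⟩ <;> push_cast <;> linarith
      · have : 2 * q < 2 * p + 1 + 1 := by
          have : ((2 * q : ℕ) : ℝ) < ((2 * p + 1 + 1 : ℕ) : ℝ) := by
            refine lt_of_mul_lt_mul_right ?_ hT.le
            push_cast; linarith
          exact_mod_cast this
        obtain ⟨r, rfl⟩ := Nat.exists_eq_add_of_le (by omega : q ≤ p)
        have h' : x ≠ (2 * (q + r) + 1) * T + d := fun h =>
          hne (2 * r + 1) 1 (by push_cast; linarith)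
        push_cast at hi1 hi2 hi1' h
        have h'' := lt_of_le_of_ne h h'.symm
        refine ⟨2 * r + 1, -1, x - π, by rw [lam_o]; push_cast; ring, ?_, ?_, ?_⟩ <;> push_cast <;> linarith
  · rintro t ⟨ht0, ht⟩
    by_contra! hlt
    refine cov_pos T t (max (2 * q * T - d) (t - 2 * π)) (2 * q * T) (max_lt (by linarith) (by linarith)) ?_ ht
    intro x hxl hxu j n a ha h1 h2 h3
    have hx1 := (le_max_left _ _).trans_lt hxl
    have hx2 := (le_max_right _ _).trans_lt hxl
    have hj0 : 0 ≤ (j : ℝ) * T := by positivity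
    rcases Nat.even_or_odd' j with ⟨p, rfl | rfl⟩
    · rw [lam_e] at ha
      have hn : n = 0 := by
        have hn1 : (n : ℝ) < 1 := by
          refine lt_of_mul_lt_mul_right (a := 2 * π) ?_ (by positivity)
          linarith
        have hn2 : (-1 : ℝ) < n := by
          refine lt_of_mul_lt_mul_right (a := 2 * π) ?_ (by positivity)
          linarith
        have hn1 : n < 1 := by exact_mod_cast hn1
        have hn2 : -1 < n := by exact_mod_cast hn2
        omega
      subst hn
      push_cast at *
      have ha1 : ((2 * p : ℕ) : ℝ) < ((2 * q : ℕ) : ℝ) := by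
        refine lt_of_mul_lt_mul_right ?_ hT.le
        push_cast; linarith
      have ha2 : ((2 * q : ℕ) : ℝ) < ((2 * p + 2 : ℕ) : ℝ) := by
        refine lt_of_mul_lt_mul_right ?_ hT.le
        push_cast; linarith
      have ha1 := Nat.cast_lt.1 ha1
      have ha2 := Nat.cast_lt.1 ha2
      omega
    · rw [lam_o] at ha
      have hn : n = 0 := by
        have hn1 : (n : ℝ) < 1 := by
          refine lt_of_mul_lt_mul_right (a := 2 * π) ?_ (by positivity)
          linarith
        have hn2 : (-1 : ℝ) < n := by
          refine lt_of_mul_lt_mul_right (a := 2 * π) ?_ (by positivity)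
          linarith
        have hn1 : n < 1 := by exact_mod_cast hn1
        have hn2 : -1 < n := by exact_mod_cast hn2
        omega
      subst hn
      push_cast at *
      have ha1 : ((2 * p + 1 : ℕ) : ℝ) < ((4 * q + 1 : ℕ) : ℝ) := by
        refine lt_of_mul_lt_mul_right ?_ hT.le
        push_cast; linarith
      have ha2 : ((4 * q : ℕ) : ℝ) < ((2 * p + 2 : ℕ) : ℝ) := by
        refine lt_of_mul_lt_mul_right ?_ hT.le
        push_cast; linarith
      have ha1 := Nat.cast_lt.1 ha1
      have ha2 := Nat.cast_lt.1 ha2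
      omega

/-- Here `K = 2 q` and `d = K T - π`. -/
lemma topt_B (q : ℕ) (T d : ℝ) (hq : 1 ≤ q) (hd : 0 < d) (hdT : 2 * d < T)
    (hpi : π = 2 * q * T - d) : Topt T = π + (4 * q - 1) * T := by
  have hT : 0 < T := by linarith
  have hp := Real.pi_pos
  have hqT : (1:ℝ) * T ≤ q * T := mul_le_mul_of_nonneg_right (by exact_mod_cast hq) hT.le
  refine IsLeast.csInf_eq ⟨⟨by linarith, cov_zero _ _ ?_⟩, ?_⟩
  · intro x hx0 hx1 hne
    obtain ⟨i, hi1, hi2⟩ : ∃ i : ℕ, i * T ≤ x ∧ x < (i + 1) * T :=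
      ⟨⌊x / T⌋₊, (le_div_iff₀ hT).1 (Nat.floor_le (by positivity)),
        (div_lt_iff₀ hT).1 (Nat.lt_floor_add_one _)⟩
    have hi1' : i * T < x := lt_of_le_of_ne hi1 (fun h => hne i 0 (by push_cast; linarith))
    rcases Nat.even_or_odd' i with ⟨p, rfl | rfl⟩
    · exact ⟨2 * p, 0, x, by rw [lam_e]; simp, hi1', hi2, by linarith⟩
    push_cast at hi1 hi2 hi1'
    rcases lt_or_ge x π with hxp | hxp
    · rcases lt_or_ge x ((2 * p + 1) * T + d) with h | h
      · have : 2 * p + 1 < 2 * q := by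
          have : ((2 * p + 1 : ℕ) : ℝ) < ((2 * q : ℕ) : ℝ) := by
            refine lt_of_mul_lt_mul_right ?_ hT.le
            push_cast; linarith
          exact_mod_cast this
        have h3 : ((p + 1 : ℕ) : ℝ) * T ≤ q * T :=
          mul_le_mul_of_nonneg_right (by exact_mod_cast (by omega : p + 1 ≤ q)) hT.le
        push_cast at h3
        refine ⟨2 * (p + 2 * q), 1, x + 2 * π, by rw [lam_e]; simp, ?_, ?_, ?_⟩ <;> push_cast <;> linarith
      · have h' : x ≠ (2 * p + 1) * T + d := fun h =>
          hne (2 * p + 1 + 2 * q) (-1) (by push_cast; linarith)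
        have h'' := lt_of_le_of_ne h h'.symm
        refine ⟨2 * (p + q) + 1, 0, x + π, by rw [lam_o]; simp, ?_, ?_, ?_⟩ <;> push_cast <;> linarith
    · rcases lt_or_ge x ((2 * p + 2) * T - d) with h | h
      · have : 2 * q < 2 * p + 2 := by
          have : ((2 * q : ℕ) : ℝ) < ((2 * p + 2 : ℕ) : ℝ) := by
            refine lt_of_mul_lt_mul_right ?_ hT.le
            push_cast; linarith
          exact_mod_cast this
        obtain ⟨r, rfl⟩ := Nat.exists_eq_add_of_le (by omega : q ≤ p)
        push_cast at hi1 hi2 hi1' h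
        refine ⟨2 * r + 1, -1, x - π, by rw [lam_o]; push_cast; ring, ?_, ?_, ?_⟩ <;> push_cast <;> linarith
      · have : 2 * p + 2 < 4 * q := by
          have : ((2 * p + 2 : ℕ) : ℝ) < ((4 * q : ℕ) : ℝ) := by
            refine lt_of_mul_lt_mul_right ?_ hT.le
            push_cast; linarith
          exact_mod_cast this
        have h3 : ((2 * p + 3 : ℕ) : ℝ) * T ≤ (4 * q : ℕ) * T :=
          mul_le_mul_of_nonneg_right (by exact_mod_cast (by omega : 2 * p + 3 ≤ 4 * q)) hT.le
        push_cast at h3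
        refine ⟨2 * (p + q) + 1, 0, x + π, by rw [lam_o]; simp, ?_, ?_, ?_⟩ <;> push_cast <;> linarith
  · rintro t ⟨ht0, ht⟩
    by_contra! hlt
    refine cov_pos T t (max ((2 * q - 1) * T) (t - 2 * π)) ((2 * q - 1) * T + d) (max_lt (by linarith) (by linarith)) ?_ ht
    intro x hxl hxu j n a ha h1 h2 h3
    have hx1 := (le_max_left _ _).trans_lt hxl
    have hx2 := (le_max_right _ _).trans_lt hxl
    have hj0 : 0 ≤ (j : ℝ) * T := by positivity
    rcases Nat.even_or_odd' j with ⟨p, rfl | rfl⟩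
    · rw [lam_e] at ha
      have hn : n = 0 := by
        have hn1 : (n : ℝ) < 1 := by
          refine lt_of_mul_lt_mul_right (a := 2 * π) ?_ (by positivity)
          linarith
        have hn2 : (-1 : ℝ) < n := by
          refine lt_of_mul_lt_mul_right (a := 2 * π) ?_ (by positivity)
          linarith
        have hn1 : n < 1 := by exact_mod_cast hn1
        have hn2 : -1 < n := by exact_mod_cast hn2
        omega
      subst hn
      push_cast at *
      have ha1 : ((2 * p : ℕ) : ℝ) < ((2 * q : ℕ) : ℝ) := by
        refine lt_of_mul_lt_mul_right ?_ hT.le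
        push_cast; linarith
      have ha2 : ((2 * q : ℕ) : ℝ) < ((2 * p + 2 : ℕ) : ℝ) := by
        refine lt_of_mul_lt_mul_right ?_ hT.le
        push_cast; linarith
      have ha1 := Nat.cast_lt.1 ha1
      have ha2 := Nat.cast_lt.1 ha2
      omega
    · rw [lam_o] at ha
      have hn : n = 0 := by
        have hn1 : (n : ℝ) < 1 := by
          refine lt_of_mul_lt_mul_right (a := 2 * π) ?_ (by positivity)
          linarith
        have hn2 : (-1 : ℝ) < n := by
          refine lt_of_mul_lt_mul_right (a := 2 * π) ?_ (by positivity)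
          linarith
        have hn1 : n < 1 := by exact_mod_cast hn1
        have hn2 : -1 < n := by exact_mod_cast hn2
        omega
      subst hn
      push_cast at *
      have ha1 : ((2 * p + 2 : ℕ) : ℝ) < ((4 * q : ℕ) : ℝ) := by
        refine lt_of_mul_lt_mul_right ?_ hT.le
        push_cast; linarith
      have ha2 : ((4 * q : ℕ) : ℝ) < ((2 * p + 4 : ℕ) : ℝ) := by
        refine lt_of_mul_lt_mul_right ?_ hT.le
        push_cast; linarith
      have ha1 := Nat.cast_lt.1 ha1
      have ha2 := Nat.cast_lt.1 ha2
      omega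

/-- Proposition 4.5: for even k the map T₀ ↦ T_opt(T₀) is continuous on
A_k = (π/(k+1/2), π/k); for odd k it is continuous on B_k = (π/(k+1), π/(k+1/2)). -/
theorem stmt_18 (k : ℕ) (hk : 1 ≤ k) :
    (Even k → ContinuousOn Topt
      (Set.Ioo (Real.pi / ((k : ℝ) + 1 / 2)) (Real.pi / (k : ℝ)))) ∧
    (Odd k → ContinuousOn Topt
      (Set.Ioo (Real.pi / ((k : ℝ) + 1)) (Real.pi / ((k : ℝ) + 1 / 2)))) := by
  refine ⟨?_, ?_⟩
  · rintro ⟨q, rfl⟩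
    have hq : 1 ≤ q := by omega
    have hq' : (1 : ℝ) ≤ q := by exact_mod_cast hq
    refine ContinuousOn.congr (f := fun T => 2 * π + 2 * q * T) (by fun_prop) ?_
    rintro T ⟨h1, h2⟩
    push_cast at h1 h2
    rw [div_lt_iff₀ (by positivity)] at h1
    rw [lt_div_iff₀ (by positivity)] at h2
    exact topt_A q T (π - 2 * q * T) hq (by linarith) (by linarith) (by ring)
  · rintro ⟨q, rfl⟩
    refine ContinuousOn.congr (f := fun T => π + (4 * (q + 1 : ℕ) - 1) * T) (by fun_prop) ?_
    rintro T ⟨h1, h2⟩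
    push_cast at h1 h2
    rw [div_lt_iff₀ (by positivity)] at h1
    rw [lt_div_iff₀ (by positivity)] at h2
    exact topt_B (q + 1) T (2 * (q + 1 : ℕ) * T - π) (by omega) (by push_cast; linarith)
      (by push_cast; linarith) (by ring)
end
end

section
/- Let k ∈ ℕ be even, k ≥ 2, and for m ∈ ℕ, m ≥ 1, set ξ_m := π / ( k + (m+1)/(m+2) ) ∈ B_k := ( π/(k+1), π/(k + 1/2) ). Then for each m ≥ 1: T_opt(t) → π·(m+3) + k·ξ_m as t → ξ_m with t < ξ_m, and T_opt(t) → π·(m+2) + k·ξ_m as t → ξ_m with t > ξ_m; in particular the left limit exceeds the right limit by exactly π at each ξ_m. -/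
open MeasureTheory Set Real Filter Topology

noncomputable section

lemma lam_eq (i : ℕ) : ∃ q : ℤ, lam i = i * π + q * (2 * π) := by
  rcases Nat.even_or_odd' i with ⟨r, h | h⟩
  · refine ⟨-r, ?_⟩
    have : Even i := ⟨r, by omega⟩
    simp only [lam, this, if_true]; rw [h]; push_cast; ring
  · refine ⟨-r, ?_⟩
    have : ¬ Even i := by rw [Nat.not_even_iff_odd]; exact ⟨r, h⟩
    simp only [lam, this, if_false]; rw [h]; push_cast; ring

lemma circ_eq {x y : ℝ} : (x : AddCircle (2 * π)) = (y : AddCircle (2 * π)) ↔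
    ∃ q : ℤ, x = y + q * (2 * π) := by
  rw [← sub_eq_zero, ← AddCircle.coe_sub, AddCircle.coe_eq_zero_iff]
  constructor
  · rintro ⟨n, h⟩; exact ⟨n, by rw [zsmul_eq_mul] at h; linarith⟩
  · rintro ⟨n, h⟩; exact ⟨n, by rw [zsmul_eq_mul]; linarith⟩

lemma mem_cov {T t x : ℝ} : (x : AddCircle (2 * π)) ∈ coveredSet T t ↔
    ∃ (i : ℕ) (q : ℤ), i * T < x + i * π + q * (2 * π) ∧
      x + i * π + q * (2 * π) < (i + 1) * T ∧ x + i * π + q * (2 * π) < t := by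
  simp only [coveredSet, mem_iUnion, mem_image, mem_Ioo, lt_min_iff]
  constructor
  · rintro ⟨i, a, ⟨h1, h2, h3⟩, h⟩
    obtain ⟨q, hq⟩ := lam_eq i
    obtain ⟨p, hp⟩ := circ_eq.1 h
    have : x + i * π + ((q - -p : ℤ) : ℝ) * (2 * π) = a := by push_cast; linarith
    exact ⟨i, q - -p, by rw [this]; exact ⟨h1, h2, h3⟩⟩
  · rintro ⟨i, q, h⟩
    obtain ⟨p, hp⟩ := lam_eq i
    refine ⟨i, _, h, circ_eq.2 ⟨q - p, ?_⟩⟩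
    push_cast; rw [hp]; ring

lemma cov_main (k : ℕ) (hke : Even k) (N : ℕ) (hN : 2 ≤ N) (T : ℝ)
    (hT : 0 < T) (h1 : ((N : ℝ) - 1) * ((k + 1) * T - π) < T)
    (h2 : T ≤ N * ((k + 1) * T - π)) (x : ℝ)
    (hx : ∀ a b : ℤ, x ≠ a * T + b * π) :
    (x : AddCircle (2 * π)) ∈ coveredSet T (k * T + N * π) := by
  have hpi := Real.pi_pos
  have hN' : (2 : ℝ) ≤ N := by exact_mod_cast hN
  obtain ⟨D, hD⟩ : ∃ D, D = (k + 1) * T - π := ⟨_, rfl⟩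
  rw [← hD] at h1 h2
  have hD0 : 0 < D := by
    by_contra h
    nlinarith
  have hDT : D < T := by nlinarith
  obtain ⟨p, hp⟩ : ∃ p : ℤ, p = ⌊x / π⌋ := ⟨_, rfl⟩
  obtain ⟨y, hy⟩ : ∃ y, y = x - p * π := ⟨_, rfl⟩
  have hy0 : 0 ≤ y := by
    have := Int.floor_le (x / π)
    rw [← hp, le_div_iff₀ hpi] at this; linarith
  have hy1 : y < π := by
    have := Int.lt_floor_add_one (x / π)
    rw [← hp, div_lt_iff₀ hpi] at this; linarith
  obtain ⟨j, hj⟩ : ∃ j : ℕ, j = ⌊y / T⌋₊ := ⟨_, rfl⟩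
  obtain ⟨f, hf⟩ : ∃ f, f = y - j * T := ⟨_, rfl⟩
  have hf0 : 0 < f := by
    have := Nat.floor_le (div_nonneg hy0 hT.le)
    rw [← hj, le_div_iff₀ hT] at this
    refine lt_of_le_of_ne (by linarith) fun h => hx j p ?_
    push_cast; linarith
  have hf1 : f < T := by
    have := Nat.lt_floor_add_one (y / T)
    rw [← hj, div_lt_iff₀ hT] at this; linarith
  obtain ⟨n, hn⟩ : ∃ n : ℕ, n = ⌊f / D⌋₊ := ⟨_, rfl⟩
  have hn0 : n * D ≤ f := by
    have := Nat.floor_le (div_nonneg hf0.le hD0.le)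
    rwa [← hn, le_div_iff₀ hD0] at this
  have hn1 : f < (n + 1) * D := by
    have := Nat.lt_floor_add_one (f / D)
    rwa [← hn, div_lt_iff₀ hD0] at this
  have hn0' : n * D < f := by
    refine lt_of_le_of_ne hn0 fun h => hx (j + n * (k + 1)) (p - n) ?_
    push_cast
    have : x = j * T + f + p * π := by linarith
    rw [this, ← h, hD]; ring
  have hjk : j ≤ k := by
    by_contra h
    have : (k : ℝ) + 1 ≤ j := by exact_mod_cast (by omega : k + 1 ≤ j)
    nlinarith
  have hkT : 0 ≤ (k : ℝ) * T := by positivity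
  have ht : y + (n + 1) * π < k * T + N * π := by
    rcases Nat.lt_or_ge j k with h | h
    · have h' : (j : ℝ) + 1 ≤ k := by exact_mod_cast h
      have hnN : n < N := by
        by_contra hh
        have : (N : ℝ) ≤ n := by exact_mod_cast (by omega : N ≤ n)
        nlinarith
      have hnN' : (n : ℝ) + 1 ≤ N := by exact_mod_cast hnN
      nlinarith
    · have h' : j = k := le_antisymm hjk h
      subst h'
      have hnN : n + 1 < N := by
        by_contra hh
        have : (N : ℝ) ≤ n + 1 := by exact_mod_cast (by omega : N ≤ n + 1)
        nlinarith
      have hnN' : (n : ℝ) + 1 + 1 ≤ N := by exact_mod_cast hnN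
      by_cases hk0 : 0 < j
      · have : 0 < (j : ℝ) * T := by positivity
        nlinarith
      · have : j = 0 := by omega
        nlinarith
  rw [mem_cov]
  obtain ⟨r, hr⟩ := hke
  rcases Int.even_or_odd' (p + j) with ⟨c, hc | hc⟩
  · refine ⟨j, -c, ?_⟩
    have hc' : (p : ℝ) + j = 2 * c := by exact_mod_cast hc
    have e : x + j * π + ((-c : ℤ) : ℝ) * (2 * π) = y := by
      push_cast
      rw [hy]; linear_combination π * hc'
    rw [e]
    refine ⟨by linarith, by linarith, ?_⟩
    nlinarith
  · obtain ⟨i, hi⟩ : ∃ i : ℕ, i = j + n * (k + 1) + k := ⟨_, rfl⟩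
    have hi' : (i : ℝ) = j + n * (k + 1) + k := by rw [hi]; push_cast; ring
    have hr' : (k : ℝ) = r + r := by exact_mod_cast hr
    refine ⟨i, -(c + n * r + r) , ?_⟩
    have hc' : (p : ℝ) + j = 2 * c + 1 := by exact_mod_cast hc
    have e : x + i * π + ((-(c + n * r + r) : ℤ) : ℝ) * (2 * π) = y + (n + 1) * π := by
      push_cast
      rw [hy, hi', hr']; linear_combination π * hc'
    rw [e]
    have e2 : y + (n + 1) * π = i * T + (T + f - (n + 1) * D) := by
      rw [hi', hD]; linear_combination -hf
    refine ⟨?_, ?_, ht⟩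
    · rw [e2]; linarith
    · rw [e2]; linarith

lemma Topt_eq (k : ℕ) (hke : Even k) (hk : 2 ≤ k) (N : ℕ) (hN : 2 ≤ N) (T : ℝ)
    (hT : 0 < T) (h1 : ((N : ℝ) - 1) * ((k + 1) * T - π) < T)
    (h2 : T ≤ N * ((k + 1) * T - π)) : Topt T = k * T + N * π := by
  have hpi := Real.pi_pos
  have hN' : (2 : ℝ) ≤ N := by exact_mod_cast hN
  have hkT : 0 ≤ (k : ℝ) * T := by positivity
  have hmem : k * T + N * π ∈ { t : ℝ | 0 < t ∧ volume (coveredSet T t)ᶜ = 0 } := by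
    refine ⟨by positivity, ?_⟩
    haveI : NullSingletonClass (volume : Measure (AddCircle (2 * π))) := ⟨fun x => by
      rw [← Metric.closedBall_zero, AddCircle.volume_closedBall]
      simp [hpi.le]⟩
    have hc : (range fun ab : ℤ × ℤ =>
        ((ab.1 * T + ab.2 * π : ℝ) : AddCircle (2 * π))).Countable := countable_range _
    refine measure_mono_null ?_ (hc.measure_zero _)
    intro z hz
    induction z using QuotientAddGroup.induction_on with
    | H x =>
      by_contra hx
      refine hz (cov_main k hke N hN T hT h1 h2 x fun a b h => hx ⟨(a, b), ?_⟩)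
      simp only [← h]
  refine le_antisymm (csInf_le ⟨0, fun t ht => ht.1.le⟩ hmem) (le_csInf ⟨_, hmem⟩ ?_)
  rintro t ⟨ht0, ht⟩
  by_contra! hlt
  obtain ⟨D, hD⟩ : ∃ D, D = (k + 1) * T - π := ⟨_, rfl⟩
  rw [← hD] at h1 h2
  have hD0 : 0 < D := by
    by_contra h
    nlinarith
  have hDT : D < T := by nlinarith
  obtain ⟨a, ha⟩ : ∃ a, a = max ((k - 1) * T + (N - 1) * D) (t - N * π) := ⟨_, rfl⟩
  have hab : a < k * T := by
    rw [ha, max_lt_iff]; constructor <;> linarith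
  have hopen : IsOpen ((fun x : ℝ => (x : AddCircle (2 * π))) '' Ioo a (k * T)) :=
    QuotientAddGroup.isOpenMap_coe _ isOpen_Ioo
  have hpos := hopen.measure_pos volume ((nonempty_Ioo.2 hab).image _)
  refine hpos.ne' (measure_mono_null ?_ ht)
  rintro _ ⟨y, ⟨hy1, hy2⟩, rfl⟩ hcov
  rw [ha, max_lt_iff] at hy1
  obtain ⟨hy1, hy3⟩ := hy1
  obtain ⟨i, q, g1, g2, g3⟩ := mem_cov.1 hcov
  obtain ⟨n, hn⟩ : ∃ n : ℤ, n = i + 2 * q := ⟨_, rfl⟩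
  have hn' : (n : ℝ) = i + 2 * q := by exact_mod_cast hn
  have e : y + i * π + q * (2 * π) = y + n * π := by rw [hn']; ring
  rw [e] at g1 g2 g3
  have hiT : 0 ≤ (i : ℝ) * T := by positivity
  have n0 : 0 ≤ n := by
    by_contra h
    have : (n : ℝ) ≤ -1 := by exact_mod_cast (by omega : n ≤ -1)
    nlinarith
  have nN : n < N := by
    by_contra h
    have : (N : ℝ) ≤ n := by exact_mod_cast (by omega : (N : ℤ) ≤ n)
    nlinarith
  have n0' : (0 : ℝ) ≤ n := by exact_mod_cast n0
  have nN' : (n : ℝ) + 1 ≤ N := by exact_mod_cast nN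
  have e2 : y + n * π = (k - 1 + n * (k + 1)) * T + (y - (k - 1) * T - n * D) := by
    rw [hD]; ring
  have b1 : 0 < y - (k - 1) * T - n * D := by nlinarith
  have b2 : y - (k - 1) * T - n * D < T := by nlinarith
  have c1 : (i : ℝ) < k - 1 + n * (k + 1) + 1 := by
    refine lt_of_mul_lt_mul_right ?_ hT.le
    linarith
  have c2 : (k - 1 + n * (k + 1) : ℝ) < i + 1 := by
    refine lt_of_mul_lt_mul_right ?_ hT.le
    linarith
  have c1' : (i : ℤ) < k - 1 + n * (k + 1) + 1 := by exact_mod_cast c1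
  have c2' : (k - 1 + n * (k + 1) : ℤ) < i + 1 := by exact_mod_cast c2
  have c3 : (i : ℤ) = k - 1 + n * (k + 1) := by omega
  obtain ⟨r, hr⟩ := hke
  have hr' : (k : ℤ) = 2 * r := by omega
  rw [hr'] at c3
  have : n * (2 * r + 1) = 2 * (n * r) + n := by ring
  rw [this] at c3
  omega

/-- Proposition 4.7: for even k ≥ 2 and m ≥ 1, at ξ_m = π/(k + (m+1)/(m+2)) ∈ B_k the
map T_opt has left limit π(m+3) + kξ_m and right limit π(m+2) + kξ_m; in particular
the left limit exceeds the right limit by exactly π. -/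
theorem stmt_19 (k : ℕ) (hke : Even k) (hk : 2 ≤ k) (m : ℕ) (hm : 1 ≤ m)
    (ξ : ℝ) (hξ : ξ = Real.pi / ((k : ℝ) + ((m : ℝ) + 1) / ((m : ℝ) + 2))) :
    ξ ∈ Set.Ioo (Real.pi / ((k : ℝ) + 1)) (Real.pi / ((k : ℝ) + 1 / 2)) ∧
    Filter.Tendsto Topt (nhdsWithin ξ (Set.Iio ξ))
      (nhds (Real.pi * ((m : ℝ) + 3) + (k : ℝ) * ξ)) ∧
    Filter.Tendsto Topt (nhdsWithin ξ (Set.Ioi ξ))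
      (nhds (Real.pi * ((m : ℝ) + 2) + (k : ℝ) * ξ)) ∧
    (Real.pi * ((m : ℝ) + 3) + (k : ℝ) * ξ) -
      (Real.pi * ((m : ℝ) + 2) + (k : ℝ) * ξ) = Real.pi := by
  have hpi := Real.pi_pos
  have hk' : (2 : ℝ) ≤ k := by exact_mod_cast hk
  have hm' : (1 : ℝ) ≤ m := by exact_mod_cast hm
  have hden : (0 : ℝ) < (k : ℝ) + ((m : ℝ) + 1) / ((m : ℝ) + 2) := by positivity
  have hξ0 : 0 < ξ := by rw [hξ]; positivity
  have key : ξ * ((m + 2) * k + m + 1) = (m + 2) * π := by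
    rw [hξ]; field_simp; ring
  refine ⟨?_, ?_, ?_, by ring⟩
  · have l1 : ((m : ℝ) + 1) / ((m : ℝ) + 2) < 1 := by rw [div_lt_one (by positivity)]; linarith
    have l2 : 1 / 2 < ((m : ℝ) + 1) / ((m : ℝ) + 2) := by
      rw [div_lt_div_iff₀ (by norm_num) (by positivity)]; linarith
    rw [hξ]
    constructor
    · exact div_lt_div_of_pos_left hpi hden (by linarith)
    · exact div_lt_div_of_pos_left hpi (by positivity) (by linarith)
  · have ev : ∀ᶠ T in 𝓝 ξ, 0 < T ∧ T < ((m + 3 : ℕ) : ℝ) * ((k + 1) * T - π) := by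
      refine (eventually_gt_nhds hξ0).and ?_
      refine ContinuousAt.eventually_lt (by fun_prop) (by fun_prop) ?_
      push_cast
      nlinarith
    have heq : Topt =ᶠ[𝓝[<] ξ] fun T => k * T + ((m + 3 : ℕ) : ℝ) * π := by
      filter_upwards [ev.filter_mono nhdsWithin_le_nhds, self_mem_nhdsWithin] with T hT hlt
      refine Topt_eq k hke hk (m + 3) (by omega) T hT.1 ?_ hT.2.le
      have hlt : T < ξ := hlt
      have : T * ((m + 2) * k + m + 1) < ξ * ((m + 2) * k + m + 1) :=
        mul_lt_mul_of_pos_right hlt (by positivity)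
      push_cast
      linarith
    refine Tendsto.congr' heq.symm ?_
    have hc : Continuous fun T : ℝ => k * T + ((m + 3 : ℕ) : ℝ) * π := by fun_prop
    have := (hc.tendsto ξ).mono_left (nhdsWithin_le_nhds (s := Iio ξ))
    convert this using 2
    push_cast; ring
  · have ev : ∀ᶠ T in 𝓝 ξ, 0 < T ∧ (((m + 2 : ℕ) : ℝ) - 1) * ((k + 1) * T - π) < T := by
      refine (eventually_gt_nhds hξ0).and ?_
      refine ContinuousAt.eventually_lt (by fun_prop) (by fun_prop) ?_
      push_cast
      nlinarith
    have heq : Topt =ᶠ[𝓝[>] ξ] fun T => k * T + ((m + 2 : ℕ) : ℝ) * π := by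
      filter_upwards [ev.filter_mono nhdsWithin_le_nhds, self_mem_nhdsWithin] with T hT hlt
      refine Topt_eq k hke hk (m + 2) (by omega) T hT.1 hT.2 ?_
      have hlt : ξ < T := hlt
      have : ξ * ((m + 2) * k + m + 1) < T * ((m + 2) * k + m + 1) :=
        mul_lt_mul_of_pos_right hlt (by positivity)
      push_cast
      linarith
    refine Tendsto.congr' heq.symm ?_
    have hc : Continuous fun T : ℝ => k * T + ((m + 2 : ℕ) : ℝ) * π := by fun_prop
    have := (hc.tendsto ξ).mono_left (nhdsWithin_le_nhds (s := Ioi ξ))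
    convert this using 2
    push_cast; ring
end
end
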